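/- Let Φ be a C² function on an open set U ⊂ ℝ² with Φ_x² + Φ_y² > 0 on U, satisfying the equation (5.9): (Φ_x² + Φ_y²)^{3/2}·(Φ_xx + Φ_yy) + Φ_x²Φ_yy − 2Φ_xΦ_yΦ_xy + Φ_y²Φ_xx = 0. Set ρ = √(Φ_x² + Φ_y²), and let ψ be any C¹ function on U with cos ψ = −Φ_x/ρ and sin ψ = Φ_y/ρ. Then ρ and ψ satisfy the system (5.8) on U: (ρ sin ψ)_x + (ρ cos ψ)_y = 0 and ((ρ+1) sin ψ)_y − ((ρ+1) cos ψ)_x = 0. -/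

import Mathlib

open Real

/-- Partial derivative in the first variable of a function on `ℝ²`. -/
noncomputable def pdx (f : ℝ × ℝ → ℝ) (p : ℝ × ℝ) : ℝ := deriv (fun t => f (t, p.2)) p.1

/-- Partial derivative in the second variable of a function on `ℝ²`. -/
noncomputable def pdy (f : ℝ × ℝ → ℝ) (p : ℝ × ℝ) : ℝ := deriv (fun t => f (p.1, t)) p.2

theorem DifferentiableAt.hasDerivAt_fderiv_fst {f : ℝ × ℝ → ℝ} {p : ℝ × ℝ}
    (hf : DifferentiableAt ℝ f p) :
    HasDerivAt (fun t => f (t, p.2)) (fderiv ℝ f p (1, 0)) p.1 :=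
  hf.hasFDerivAt.comp_hasDerivAt p.1 ((hasDerivAt_id p.1).prodMk (hasDerivAt_const p.1 p.2))

theorem DifferentiableAt.hasDerivAt_fderiv_snd {f : ℝ × ℝ → ℝ} {p : ℝ × ℝ}
    (hf : DifferentiableAt ℝ f p) :
    HasDerivAt (fun t => f (p.1, t)) (fderiv ℝ f p (0, 1)) p.2 :=
  hf.hasFDerivAt.comp_hasDerivAt p.2 ((hasDerivAt_const p.2 p.1).prodMk (hasDerivAt_id p.2))

theorem DifferentiableAt.hasDerivAt_pdx {f : ℝ × ℝ → ℝ} {p : ℝ × ℝ}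
    (hf : DifferentiableAt ℝ f p) : HasDerivAt (fun t => f (t, p.2)) (pdx f p) p.1 :=
  hf.hasDerivAt_fderiv_fst.differentiableAt.hasDerivAt

theorem DifferentiableAt.hasDerivAt_pdy {f : ℝ × ℝ → ℝ} {p : ℝ × ℝ}
    (hf : DifferentiableAt ℝ f p) : HasDerivAt (fun t => f (p.1, t)) (pdy f p) p.2 :=
  hf.hasDerivAt_fderiv_snd.differentiableAt.hasDerivAt

theorem DifferentiableAt.pdx_eq {f : ℝ × ℝ → ℝ} {p : ℝ × ℝ} (hf : DifferentiableAt ℝ f p) :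
    pdx f p = fderiv ℝ f p (1, 0) :=
  hf.hasDerivAt_fderiv_fst.deriv

theorem DifferentiableAt.pdy_eq {f : ℝ × ℝ → ℝ} {p : ℝ × ℝ} (hf : DifferentiableAt ℝ f p) :
    pdy f p = fderiv ℝ f p (0, 1) :=
  hf.hasDerivAt_fderiv_snd.deriv

theorem pdx_congr {U : Set (ℝ × ℝ)} (hU : IsOpen U) {f g : ℝ × ℝ → ℝ} (h : Set.EqOn f g U)
    {p : ℝ × ℝ} (hp : p ∈ U) : pdx f p = pdx g p := by
  have hc : ContinuousAt (fun t : ℝ => (t, p.2)) p.1 := by fun_prop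
  exact Filter.EventuallyEq.deriv_eq
    ((hc.eventually (hU.mem_nhds hp)).mono fun _ ht => h ht)

theorem pdy_congr {U : Set (ℝ × ℝ)} (hU : IsOpen U) {f g : ℝ × ℝ → ℝ} (h : Set.EqOn f g U)
    {p : ℝ × ℝ} (hp : p ∈ U) : pdy f p = pdy g p := by
  have hc : ContinuousAt (fun t : ℝ => (p.1, t)) p.2 := by fun_prop
  exact Filter.EventuallyEq.deriv_eq
    ((hc.eventually (hU.mem_nhds hp)).mono fun _ ht => h ht)

section SecondOrder

variable {U : Set (ℝ × ℝ)} {Φ : ℝ × ℝ → ℝ} {p : ℝ × ℝ}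

theorem differentiableAt_fderiv_of_contDiffOn_two (hU : IsOpen U) (hΦ : ContDiffOn ℝ 2 Φ U)
    (hp : p ∈ U) : DifferentiableAt ℝ (fderiv ℝ Φ) p :=
  ((hΦ.contDiffAt (hU.mem_nhds hp)).fderiv_right (m := 1) (by norm_num)).differentiableAt
    (by norm_num)

theorem eqOn_pdx_fderiv (hU : IsOpen U) (hΦ : ContDiffOn ℝ 2 Φ U) :
    Set.EqOn (pdx Φ) (fun q => fderiv ℝ Φ q (1, 0)) U := fun _ hq =>
  ((hΦ.contDiffAt (hU.mem_nhds hq)).differentiableAt (by norm_num)).pdx_eq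

theorem eqOn_pdy_fderiv (hU : IsOpen U) (hΦ : ContDiffOn ℝ 2 Φ U) :
    Set.EqOn (pdy Φ) (fun q => fderiv ℝ Φ q (0, 1)) U := fun _ hq =>
  ((hΦ.contDiffAt (hU.mem_nhds hq)).differentiableAt (by norm_num)).pdy_eq

theorem differentiableAt_pdx (hU : IsOpen U) (hΦ : ContDiffOn ℝ 2 Φ U) (hp : p ∈ U) :
    DifferentiableAt ℝ (pdx Φ) p :=
  ((differentiableAt_fderiv_of_contDiffOn_two hU hΦ hp).clm_apply
    (differentiableAt_const _)).congr_of_eventuallyEq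
    ((eqOn_pdx_fderiv hU hΦ).eventuallyEq_of_mem (hU.mem_nhds hp))

theorem differentiableAt_pdy (hU : IsOpen U) (hΦ : ContDiffOn ℝ 2 Φ U) (hp : p ∈ U) :
    DifferentiableAt ℝ (pdy Φ) p :=
  ((differentiableAt_fderiv_of_contDiffOn_two hU hΦ hp).clm_apply
    (differentiableAt_const _)).congr_of_eventuallyEq
    ((eqOn_pdy_fderiv hU hΦ).eventuallyEq_of_mem (hU.mem_nhds hp))

/-- Symmetry of the mixed second partial derivatives. -/
theorem pdx_pdy_comm (hU : IsOpen U) (hΦ : ContDiffOn ℝ 2 Φ U) (hp : p ∈ U) :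
    pdx (pdy Φ) p = pdy (pdx Φ) p := by
  have hd := differentiableAt_fderiv_of_contDiffOn_two hU hΦ hp
  have hs : IsSymmSndFDerivAt ℝ Φ p :=
    (hΦ.contDiffAt (hU.mem_nhds hp)).isSymmSndFDerivAt (by simp)
  rw [pdx_congr hU (eqOn_pdy_fderiv hU hΦ) hp, pdy_congr hU (eqOn_pdx_fderiv hU hΦ) hp,
    (hd.clm_apply (differentiableAt_const _)).pdx_eq,
    (hd.clm_apply (differentiableAt_const _)).pdy_eq,
    fderiv_clm_apply hd (differentiableAt_const _),
    fderiv_clm_apply hd (differentiableAt_const _)]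
  simpa using hs (1, 0) (0, 1)

end SecondOrder

/-- Derivative of `(r + 1) * (c / r)` with `r = √(a² + b²)`. -/
theorem hasDerivAt_add_div_sqrt {a b c : ℝ → ℝ} {a' b' c' t : ℝ} (ha : HasDerivAt a a' t)
    (hb : HasDerivAt b b' t) (hc : HasDerivAt c c' t) (h : 0 < a t ^ 2 + b t ^ 2) :
    HasDerivAt (fun s => c s + c s / √(a s ^ 2 + b s ^ 2))
      (c' + (c' * (a t ^ 2 + b t ^ 2) - c t * (a t * a' + b t * b')) /
        √(a t ^ 2 + b t ^ 2) ^ 3) t := by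
  have hr : 0 < √(a t ^ 2 + b t ^ 2) := Real.sqrt_pos.2 h
  have hsq := Real.sq_sqrt h.le
  have := hc.add (hc.div (((ha.pow 2).add (hb.pow 2)).sqrt h.ne') hr.ne')
  refine this.congr_deriv ?_
  simp only [Pi.add_apply, Pi.pow_apply]
  generalize √(a t ^ 2 + b t ^ 2) = r at hr hsq ⊢
  rw [← hsq]
  field_simp
  push_cast
  ring

/-- If the potential `Φ` solves equation (5.9) and has nonvanishing
gradient, then `ρ = |∇Φ|` and the angle `ψ` defined by `cos ψ = −Φ_x/ρ`, `sin ψ = Φ_y/ρ`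
solve the system (5.8). -/
theorem statement10 (U : Set (ℝ × ℝ)) (hU : IsOpen U)
    (Φ : ℝ × ℝ → ℝ) (hΦ : ContDiffOn ℝ 2 Φ U)
    (hgrad : ∀ p ∈ U, 0 < pdx Φ p ^ 2 + pdy Φ p ^ 2)
    (h59 : ∀ p ∈ U,
      (pdx Φ p ^ 2 + pdy Φ p ^ 2) ^ ((3 : ℝ) / 2) * (pdx (pdx Φ) p + pdy (pdy Φ) p)
        + pdx Φ p ^ 2 * pdy (pdy Φ) p - 2 * pdx Φ p * pdy Φ p * pdy (pdx Φ) p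
        + pdy Φ p ^ 2 * pdx (pdx Φ) p = 0)
    (ρ : ℝ × ℝ → ℝ) (hρdef : ρ = fun p => Real.sqrt (pdx Φ p ^ 2 + pdy Φ p ^ 2))
    (ψ : ℝ × ℝ → ℝ) (hψ : ContDiffOn ℝ 1 ψ U)
    (hcos : ∀ p ∈ U, Real.cos (ψ p) = -pdx Φ p / ρ p)
    (hsin : ∀ p ∈ U, Real.sin (ψ p) = pdy Φ p / ρ p) :
    ∀ p ∈ U,
      pdx (fun q => ρ q * Real.sin (ψ q)) p + pdy (fun q => ρ q * Real.cos (ψ q)) p = 0 ∧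
      pdy (fun q => (ρ q + 1) * Real.sin (ψ q)) p
        - pdx (fun q => (ρ q + 1) * Real.cos (ψ q)) p = 0 := by
  intro p hp
  have hρpos : ∀ q ∈ U, 0 < ρ q := fun q hq => by
    rw [hρdef]; exact Real.sqrt_pos.2 (hgrad q hq)
  have ha := differentiableAt_pdx hU hΦ hp
  have hb := differentiableAt_pdy hU hΦ hp
  have hs : Set.EqOn (fun q => ρ q * Real.sin (ψ q)) (pdy Φ) U := fun q hq => by
    simp only [hsin q hq]
    exact mul_div_cancel₀ _ (hρpos q hq).ne'
  have hc : Set.EqOn (fun q => ρ q * Real.cos (ψ q)) (fun q => -pdx Φ q) U := fun q hq => by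
    simp only [hcos q hq]
    exact mul_div_cancel₀ _ (hρpos q hq).ne'
  have hs1 : Set.EqOn (fun q => (ρ q + 1) * Real.sin (ψ q))
      (fun q => pdy Φ q + pdy Φ q / √(pdx Φ q ^ 2 + pdy Φ q ^ 2)) U := fun q hq => by
    have h1 : ρ q * Real.sin (ψ q) = pdy Φ q := hs hq
    have h2 : √(pdx Φ q ^ 2 + pdy Φ q ^ 2) = ρ q := by rw [hρdef]
    simp only [add_mul, one_mul, h1, h2]
    rw [hsin q hq]
  have hc1 : Set.EqOn (fun q => (ρ q + 1) * Real.cos (ψ q))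
      (fun q => -(pdx Φ q + pdx Φ q / √(pdx Φ q ^ 2 + pdy Φ q ^ 2))) U := fun q hq => by
    have h1 : ρ q * Real.cos (ψ q) = -pdx Φ q := hc hq
    have h2 : √(pdx Φ q ^ 2 + pdy Φ q ^ 2) = ρ q := by rw [hρdef]
    simp only [add_mul, one_mul, h1, h2]
    rw [hcos q hq]
    ring
  constructor
  · rw [pdx_congr hU hs hp, pdy_congr hU hc hp, pdx_pdy_comm hU hΦ hp,
      show pdy (fun q => -pdx Φ q) p = -pdy (pdx Φ) p from ha.hasDerivAt_pdy.neg.deriv,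
      add_neg_cancel]
  · have hpos := hgrad p hp
    have hy := (hasDerivAt_add_div_sqrt ha.hasDerivAt_pdy hb.hasDerivAt_pdy
      hb.hasDerivAt_pdy hpos).deriv
    have hx := (hasDerivAt_add_div_sqrt ha.hasDerivAt_pdx hb.hasDerivAt_pdx
      ha.hasDerivAt_pdx hpos).neg.deriv
    rw [pdy_congr hU hs1 hp, pdx_congr hU hc1 hp]
    refine (congrArg₂ (· - ·) hy hx).trans ?_
    have hpow : (pdx Φ p ^ 2 + pdy Φ p ^ 2) ^ ((3 : ℝ) / 2)
        = √(pdx Φ p ^ 2 + pdy Φ p ^ 2) ^ 3 := by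
      rw [Real.rpow_div_two_eq_sqrt _ hpos.le]
      exact_mod_cast Real.rpow_natCast _ 3
    have h := h59 p hp
    rw [hpow] at h
    have hr : √(pdx Φ p ^ 2 + pdy Φ p ^ 2) ≠ 0 := (Real.sqrt_pos.2 hpos).ne'
    simp only [pdx_pdy_comm hU hΦ hp, Prod.mk.eta]
    generalize √(pdx Φ p ^ 2 + pdy Φ p ^ 2) = r at h hr ⊢
    field_simp
    linear_combination h
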